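/- arXiv:alg-geom/9703001 — 2 statements merged into one kernel-verified Lean document; each statement's English description precedes it below -/
import Mathlib

section
/- Let u, w ∈ S_∞ and let k be a positive integer. Then u ≤_k w if and only if both of the following hold: (I) for every a ≤ k one has u(a) ≤ w(a), and for every b > k one has u(b) ≥ w(b); (II) for all a < b with u(a) < u(b) and w(a) > w(b), one has a ≤ k < b. -/
/-- `S_∞`: a permutation of the positive integers lies in `S_∞` iff it
fixes all but finitely many integers. -/
def finSupp (w : Equiv.Perm ℕ+) : Prop := {i : ℕ+ | w i ≠ i}.Finite

/-- The length `ℓ(w) = #{(i,j) : i < j and w(i) > w(j)}`. -/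
noncomputable def len (w : Equiv.Perm ℕ+) : ℕ :=
  {p : ℕ+ × ℕ+ | p.1 < p.2 ∧ w p.2 < w p.1}.ncard

/-- Cover relation of the `k`-Bruhat order: `w = u∘(a,b)` with `a ≤ k < b`
and `ℓ(w) = ℓ(u) + 1`. -/
def kBruhatCover (k : ℕ) (u w : Equiv.Perm ℕ+) : Prop :=
  ∃ a b : ℕ+, (a : ℕ) ≤ k ∧ k < (b : ℕ) ∧ w = u * Equiv.swap a b ∧ len w = len u + 1

/-- The `k`-Bruhat order `≤_k`: reflexive–transitive closure of the cover relation. -/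
def kBruhatLE (k : ℕ) : Equiv.Perm ℕ+ → Equiv.Perm ℕ+ → Prop :=
  Relation.ReflTransGen (kBruhatCover k)

/-- Conditions I–II for `k`:
(I) `u(a) ≤ w(a)` for `a ≤ k` and `w(b) ≤ u(b)` for `b > k`;
(II) if `a < b`, `u(a) < u(b)` and `w(a) > w(b)` then `a ≤ k < b`. -/
def condIandII (k : ℕ) (u w : Equiv.Perm ℕ+) : Prop :=
  (∀ a : ℕ+, (a : ℕ) ≤ k → u a ≤ w a) ∧
  (∀ b : ℕ+, k < (b : ℕ) → w b ≤ u b) ∧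
  (∀ a b : ℕ+, a < b → u a < u b → w b < w a → (a : ℕ) ≤ k ∧ k < (b : ℕ))

/-- The set of inversions of a permutation, as pairs of positions. -/
def inversions (w : Equiv.Perm ℕ+) : Set (ℕ+ × ℕ+) :=
  {p | p.1 < p.2 ∧ w p.2 < w p.1}

theorem len_eq_ncard_inversions (w : Equiv.Perm ℕ+) : len w = (inversions w).ncard := rfl

theorem finite_inversions {w : Equiv.Perm ℕ+} (hw : finSupp w) : (inversions w).Finite := by
  obtain ⟨N, hN⟩ := hw.bddAbove
  have hfix : ∀ i, N < i → w i = i := fun i hi => by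
    by_contra h
    exact absurd (hN h) (not_le.2 hi)
  refine ((Set.finite_Iic N).prod (Set.finite_Iic N)).subset ?_
  rintro ⟨i, j⟩ ⟨hij, hw'⟩
  simp only [Set.mem_prod, Set.mem_Iic] at *
  have hj : j ≤ N := by
    by_contra! hj
    rw [hfix j hj] at hw'
    have h := w.injective (hfix (w i) (hj.trans hw'))
    rw [h] at hw'
    exact absurd hw' (not_lt.2 hij.le)
  exact ⟨hij.le.trans hj, hj⟩

theorem finSupp_mul_swap {w : Equiv.Perm ℕ+} (hw : finSupp w) (a b : ℕ+) :
    finSupp (w * Equiv.swap a b) := by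
  refine (hw.union (Set.toFinite {a, b})).subset fun i hi => ?_
  by_contra h
  simp only [Set.mem_union, Set.mem_ofPred_eq, Set.mem_insert_iff, Set.mem_singleton_iff,
    not_or, not_not] at h
  apply hi
  rw [Equiv.Perm.mul_apply, Equiv.swap_apply_of_ne_of_ne h.2.1 h.2.2, h.1]

/-- Relabel an increasing pair of positions by the transposition `(a, b)` whenever the result is
again increasing; otherwise leave it unchanged. -/
def relabel (a b : ℕ+) (p : ℕ+ × ℕ+) : ℕ+ × ℕ+ :=
  if Equiv.swap a b p.1 < Equiv.swap a b p.2 then (Equiv.swap a b p.1, Equiv.swap a b p.2) else p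

theorem relabel_relabel (a b : ℕ+) {p : ℕ+ × ℕ+} (hp : p.1 < p.2) :
    relabel a b (relabel a b p) = p := by
  by_cases h : Equiv.swap a b p.1 < Equiv.swap a b p.2
  · simp [relabel, h, hp]
  · simp [relabel, h]

theorem injOn_relabel (a b : ℕ+) (u : Equiv.Perm ℕ+) :
    Set.InjOn (relabel a b) (inversions u) := fun p hp q hq h => by
  rw [← relabel_relabel a b hp.1, h, relabel_relabel a b hq.1]

theorem relabel_mem_inversions {u : Equiv.Perm ℕ+} {a b : ℕ+} (hab : a < b) (h : u a < u b)
    {p : ℕ+ × ℕ+} (hp : p ∈ inversions u) :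
    relabel a b p ∈ inversions (u * Equiv.swap a b) := by
  obtain ⟨i, j⟩ := p
  obtain ⟨hij, hu⟩ := hp
  simp only at hij hu
  by_cases ht : Equiv.swap a b i < Equiv.swap a b j
  · simp [relabel, inversions, ht, hu]
  · simp only [relabel, ht, if_false, inversions, Set.mem_ofPred_eq, Equiv.Perm.mul_apply]
    refine ⟨hij, ?_⟩
    simp only [Equiv.swap_apply_def] at ht ⊢
    grind

theorem notMem_image_relabel {u : Equiv.Perm ℕ+} {a b i : ℕ+} (hib : i ≤ b) (hai : a < i)
    (h : u a < u i) : (a, i) ∉ relabel a b '' inversions u := by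
  rintro ⟨p, hp, hpe⟩
  have h1 := relabel_relabel a b hp.1
  have h2 : relabel a b (a, i) = (a, i) := by
    simp only [relabel, Equiv.swap_apply_def]
    grind
  rw [hpe, h2] at h1
  rw [← h1] at hp
  exact absurd hp.2 (not_lt.2 h.le)

theorem insert_image_relabel_subset {u : Equiv.Perm ℕ+} {a b : ℕ+} (hab : a < b)
    (h : u a < u b) :
    insert (a, b) (relabel a b '' inversions u) ⊆ inversions (u * Equiv.swap a b) := by
  rintro p (rfl | ⟨q, hq, rfl⟩)
  · simp [inversions, hab, h]
  · exact relabel_mem_inversions hab h hq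

theorem ncard_insert_image_relabel {u : Equiv.Perm ℕ+} (hu : finSupp u) {a b : ℕ+} (hab : a < b)
    (h : u a < u b) :
    (insert (a, b) (relabel a b '' inversions u)).ncard = len u + 1 := by
  rw [Set.ncard_insert_of_notMem (notMem_image_relabel le_rfl hab h)
    ((finite_inversions hu).image _), (injOn_relabel a b u).ncard_image,
    len_eq_ncard_inversions]

theorem len_lt_len_mul_swap {u : Equiv.Perm ℕ+} (hu : finSupp u) {a b : ℕ+} (hab : a < b)
    (h : u a < u b) : len u < len (u * Equiv.swap a b) := by
  rw [Nat.lt_iff_add_one_le, ← ncard_insert_image_relabel hu hab h]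
  exact Set.ncard_le_ncard (insert_image_relabel_subset hab h)
    (finite_inversions (finSupp_mul_swap hu a b))

theorem len_mul_swap_of_forall_between {u : Equiv.Perm ℕ+} (hu : finSupp u) {a b : ℕ+}
    (hab : a < b) (h : u a < u b)
    (hbetween : ∀ i, a < i → i < b → u a < u i → u b < u i) :
    len (u * Equiv.swap a b) = len u + 1 := by
  rw [← ncard_insert_image_relabel hu hab h]
  refine congrArg Set.ncard (Set.Subset.antisymm ?_ (insert_image_relabel_subset hab h))
  rintro ⟨i, j⟩ ⟨hij, hinv⟩
  simp only [Equiv.Perm.mul_apply] at hij hinv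
  by_cases hp : (i, j) = (a, b)
  · exact Or.inl hp
  refine Or.inr ⟨relabel a b (i, j), ?_, relabel_relabel a b hij⟩
  by_cases ht : Equiv.swap a b i < Equiv.swap a b j
  · simp [relabel, inversions, ht, hinv]
  · simp only [relabel, ht, if_false, inversions, Set.mem_ofPred_eq]
    refine ⟨hij, ?_⟩
    have hja := u.injective.eq_iff (a := j) (b := a)
    have hib := u.injective.eq_iff (a := i) (b := b)
    have hj := lt_trichotomy j b
    have hi := lt_trichotomy a i
    have huj := lt_trichotomy (u a) (u j)
    have hui := lt_trichotomy (u i) (u b)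
    simp only [Equiv.swap_apply_def] at ht hinv
    split_ifs at ht hinv <;> grind

/-- A length-increasing transposition that adds exactly one inversion exchanges an increasing pair
of values with no intermediate value at an intermediate position. -/
theorem lt_and_forall_between_of_len_mul_swap {u : Equiv.Perm ℕ+} (hu : finSupp u) {a b : ℕ+}
    (hab : a < b) (hlen : len (u * Equiv.swap a b) = len u + 1) :
    u a < u b ∧ ∀ i, a < i → i < b → u a < u i → u b < u i := by
  have h : u a < u b := by
    by_contra! h
    have h' : u b < u a := lt_of_le_of_ne h (u.injective.ne hab.ne')
    have := len_lt_len_mul_swap (finSupp_mul_swap hu a b) hab (by simpa using h')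
    rw [mul_assoc, Equiv.swap_mul_self, mul_one] at this
    omega
  refine ⟨h, fun i hai hib hui => ?_⟩
  by_contra! hi
  have hi' : u i < u b := lt_of_le_of_ne hi (u.injective.ne hib.ne)
  have hsub : insert (a, i) (insert (a, b) (relabel a b '' inversions u)) ⊆
      inversions (u * Equiv.swap a b) := by
    refine Set.insert_subset ?_ (insert_image_relabel_subset hab h)
    simp [inversions, hai, hi', Equiv.swap_apply_of_ne_of_ne hai.ne' hib.ne]
  have hcard := Set.ncard_le_ncard hsub (finite_inversions (finSupp_mul_swap hu a b))
  rw [Set.ncard_insert_of_notMem ?_ (((finite_inversions hu).image _).insert _),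
    ncard_insert_image_relabel hu hab h, ← len_eq_ncard_inversions] at hcard
  · omega
  · rintro (hmem | hmem)
    · exact hib.ne (Prod.ext_iff.1 hmem).2
    · exact notMem_image_relabel hib.le hai hui hmem

theorem condIandII_refl (k : ℕ) (u : Equiv.Perm ℕ+) : condIandII k u u :=
  ⟨fun _ _ => le_rfl, fun _ _ => le_rfl, fun _ _ _ h h' => absurd h (not_lt.2 h'.le)⟩

theorem condIandII_of_cover {k : ℕ} {u v w : Equiv.Perm ℕ+} (hv : finSupp v)
    (huv : condIandII k u v) (hvw : kBruhatCover k v w) : condIandII k u w := by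
  obtain ⟨a, b, hak, hkb, rfl, hlen⟩ := hvw
  have hab : a < b := PNat.coe_lt_coe a b |>.1 (by omega)
  obtain ⟨h, hbetween⟩ := lt_and_forall_between_of_len_mul_swap hv hab hlen
  obtain ⟨h1, h2, h3⟩ := huv
  refine ⟨fun c hc => ?_, fun c hc => ?_, fun c d hcd hu hw => ?_⟩
  · have hcb : c ≠ b := by rintro rfl; omega
    have := h1 c hc
    simp only [Equiv.Perm.mul_apply, Equiv.swap_apply_def]
    grind
  · have hca : c ≠ a := by rintro rfl; omega
    have := h2 c hc
    simp only [Equiv.Perm.mul_apply, Equiv.swap_apply_def]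
    grind
  · by_contra hside
    have hcd' := PNat.coe_lt_coe c d |>.2 hcd
    have hv : v c < v d :=
      lt_of_le_of_ne (not_lt.1 fun h' => hside (h3 c d hcd hu h')) (v.injective.ne hcd.ne)
    have hsame : (d : ℕ) ≤ k ∨ k < (c : ℕ) := by omega
    simp only [Equiv.Perm.mul_apply, Equiv.swap_apply_def] at hw
    rcases hsame with hd | hc
    · have hcb : c ≠ b := by rintro rfl; omega
      have hdb : d ≠ b := by rintro rfl; omega
      have hdb' : d < b := PNat.coe_lt_coe d b |>.1 (by omega)
      grind
    · have hca : c ≠ a := by rintro rfl; omega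
      have hda : d ≠ a := by rintro rfl; omega
      have hac : a < c := PNat.coe_lt_coe a c |>.1 (by omega)
      have := hbetween c hac
      grind

theorem finSupp_and_condIandII_of_kBruhatLE {k : ℕ} {u w : Equiv.Perm ℕ+} (hu : finSupp u)
    (h : kBruhatLE k u w) : finSupp w ∧ condIandII k u w := by
  induction h with
  | refl => exact ⟨hu, condIandII_refl k u⟩
  | tail _ hcover ih =>
    refine ⟨?_, condIandII_of_cover ih.1 ih.2 hcover⟩
    obtain ⟨a, b, -, -, rfl, -⟩ := hcover
    exact finSupp_mul_swap ih.1 a b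

theorem eq_of_forall_le {u w : Equiv.Perm ℕ+} (h : ∀ i, w i ≤ u i) : u = w := by
  suffices ∀ n i, u i = n → w i = n from Equiv.ext fun i => (this _ i rfl).symm
  intro n
  induction n using WellFoundedLT.induction with
  | ind n ih =>
    intro i hi
    by_contra hne
    have hlt : w i < n := lt_of_le_of_ne (hi ▸ h i) hne
    have hfix := w.injective (ih (w i) hlt (u.symm (w i)) (by simp))
    exact hlt.ne (((Equiv.symm_apply_eq u).1 hfix).trans hi)

theorem exists_lt_of_condIandII {k : ℕ} {u w : Equiv.Perm ℕ+} (h : condIandII k u w)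
    (hne : u ≠ w) : ∃ a : ℕ+, (a : ℕ) ≤ k ∧ u a < w a := by
  by_contra! hno
  refine hne (eq_of_forall_le fun i => ?_)
  rcases le_or_gt (i : ℕ) k with hi | hi
  · exact hno i hi
  · exact h.2.1 i hi

/-- The position of largest value among the first `k` positions where `u` and `w` differ. -/
theorem exists_maximal_lt_of_condIandII {k : ℕ} {u w : Equiv.Perm ℕ+} (h : condIandII k u w)
    (hne : u ≠ w) : ∃ a : ℕ+, (a : ℕ) ≤ k ∧ u a < w a ∧
      ∀ i : ℕ+, (i : ℕ) ≤ k → u a < u i → w i = u i := by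
  have hfin : {a : ℕ+ | (a : ℕ) ≤ k ∧ u a < w a}.Finite :=
    ((Set.finite_Iic k).preimage PNat.coe_injective.injOn).subset fun a ha => ha.1
  obtain ⟨a, ⟨hak, ha⟩, hmax⟩ :=
    Set.exists_max_image _ u hfin (exists_lt_of_condIandII h hne)
  refine ⟨a, hak, ha, fun i hi hai => ?_⟩
  by_contra hne
  exact absurd hai (not_lt.2 (hmax i ⟨hi, lt_of_le_of_ne (h.1 i hi) (Ne.symm hne)⟩))

theorem exists_minimal_of_maximal {k : ℕ} {u w : Equiv.Perm ℕ+} (h : condIandII k u w)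
    {a : ℕ+} (ha : u a < w a)
    (hmax : ∀ i : ℕ+, (i : ℕ) ≤ k → u a < u i → w i = u i) :
    ∃ b : ℕ+, k < (b : ℕ) ∧ u a < u b ∧ u b ≤ w a ∧ w b ≤ u a ∧
      ∀ i : ℕ+, k < (i : ℕ) → u a < u i → u i < u b → u a < w i := by
  have hex : ∃ b : ℕ+, k < (b : ℕ) ∧ u a < u b ∧ u b ≤ w a ∧ w b ≤ u a := by
    by_contra! hno
    have hmaps : ∀ i, u i ∈ Finset.Ioc (u a) (w a) → w i ∈ Finset.Ioc (u a) (w a) := by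
      intro i hi
      rw [Finset.mem_Ioc] at hi ⊢
      rcases le_or_gt (i : ℕ) k with hik | hik
      · rwa [hmax i hik hi.1]
      · exact ⟨hno i hik hi.1 hi.2, (h.2.1 i hik).trans hi.2⟩
    have hsurj := Finset.surj_on_of_inj_on_of_card_le (s := Finset.Ioc (u a) (w a))
      (t := Finset.Ioc (u a) (w a)) (fun x _ => w (u.symm x))
      (fun x hx => hmaps _ (by simpa using hx))
      (fun x y _ _ hxy => u.symm.injective (w.injective hxy)) le_rfl (w a)
      (Finset.mem_Ioc.2 ⟨ha, le_rfl⟩)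
    obtain ⟨x, hx, hxa⟩ := hsurj
    have : a = u.symm x := w.injective hxa
    simp [this] at hx
  obtain ⟨b, ⟨hkb, hab, hba, hwb⟩, hmin⟩ :=
    (InvImage.wf u wellFounded_lt).has_min _ hex
  refine ⟨b, hkb, hab, hba, hwb, fun i hi hai hib => ?_⟩
  by_contra! hwi
  exact hmin i ⟨hi, hai, hib.le.trans hba, hwi⟩ hib

/-- If conditions I and II hold for `u ≠ w`, one can move up from `u` by a cover without leaving
the region where they hold. -/
theorem exists_cover_condIandII {k : ℕ} {u w : Equiv.Perm ℕ+} (hu : finSupp u)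
    (h : condIandII k u w) (hne : u ≠ w) :
    ∃ a b : ℕ+, (a : ℕ) ≤ k ∧ k < (b : ℕ) ∧ u a < u b ∧
      kBruhatCover k u (u * Equiv.swap a b) ∧ condIandII k (u * Equiv.swap a b) w := by
  obtain ⟨a, hak, ha, hmax⟩ := exists_maximal_lt_of_condIandII h hne
  obtain ⟨b, hkb, hab, hba, hwb, hmin⟩ := exists_minimal_of_maximal h ha hmax
  obtain ⟨h1, h2, h3⟩ := h
  have hlt : a < b := PNat.coe_lt_coe a b |>.1 (by omega)
  refine ⟨a, b, hak, hkb, hab, ⟨a, b, hak, hkb, rfl, ?_⟩, ?_, ?_, ?_⟩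
  · refine len_mul_swap_of_forall_between hu hlt hab fun i hai hib hui => ?_
    by_contra! hub
    have hub' : u i < u b := lt_of_le_of_ne hub (u.injective.ne hib.ne)
    rcases le_or_gt (i : ℕ) k with hik | hik
    · have := h3 a i hai hui (by rw [hmax i hik hui]; exact hub'.trans_le hba)
      omega
    · have := h3 i b hib hub' (hwb.trans_lt (hmin i hik hui hub'))
      omega
  · intro c hc
    have hcb : c ≠ b := by rintro rfl; omega
    have := h1 c hc
    simp only [Equiv.Perm.mul_apply, Equiv.swap_apply_def]
    grind
  · intro c hc
    have hca : c ≠ a := by rintro rfl; omega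
    have := h2 c hc
    simp only [Equiv.Perm.mul_apply, Equiv.swap_apply_def]
    grind
  · intro c d hcd hv hw
    by_contra hside
    have hcd' := PNat.coe_lt_coe c d |>.2 hcd
    have hud : u d < u c :=
      lt_of_le_of_ne (not_lt.1 fun h' => hside (h3 c d hcd h' hw)) (u.injective.ne hcd.ne')
    have hsame : (d : ℕ) ≤ k ∨ k < (c : ℕ) := by omega
    simp only [Equiv.Perm.mul_apply, Equiv.swap_apply_def] at hv
    rcases hsame with hd | hc
    · have hcb : c ≠ b := by rintro rfl; omega
      have hdb : d ≠ b := by rintro rfl; omega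
      have := hmax c (by omega)
      grind
    · have hca : c ≠ a := by rintro rfl; omega
      have hda : d ≠ a := by rintro rfl; omega
      have := hmin d (by omega)
      grind

theorem kBruhatLE_of_condIandII {k : ℕ+} {u w : Equiv.Perm ℕ+} (hu : finSupp u)
    (h : condIandII k u w) : kBruhatLE k u w := by
  induction hn : ∑ i ∈ Finset.Iic k, (w i : ℕ) -
      ∑ i ∈ Finset.Iic k, (u i : ℕ) using Nat.strong_induction_on generalizing u with
  | _ n ih =>
    by_cases hne : u = w
    · exact hne ▸ Relation.ReflTransGen.refl
    obtain ⟨a, b, hak, hkb, hab, hcover, h'⟩ := exists_cover_condIandII hu h hne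
    refine Relation.ReflTransGen.head hcover (ih _ ?_ (finSupp_mul_swap hu a b) h' rfl)
    have hle : ∑ i ∈ Finset.Iic k, ((u * Equiv.swap a b) i : ℕ) ≤
        ∑ i ∈ Finset.Iic k, (w i : ℕ) :=
      Finset.sum_le_sum fun i hi => h'.1 i (PNat.coe_le_coe i k |>.2 (Finset.mem_Iic.1 hi))
    have hlt : ∑ i ∈ Finset.Iic k, (u i : ℕ) <
        ∑ i ∈ Finset.Iic k, ((u * Equiv.swap a b) i : ℕ) := by
      refine Finset.sum_lt_sum (fun i hi => ?_) ⟨a, Finset.mem_Iic.2 hak, by simpa using hab⟩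
      have hik : (i : ℕ) ≤ (k : ℕ) := PNat.coe_le_coe i k |>.2 (Finset.mem_Iic.1 hi)
      have hib : i ≠ b := by rintro rfl; omega
      simp only [Equiv.Perm.mul_apply, Equiv.swap_apply_def, PNat.coe_le_coe]
      grind
    omega

/-- Theorem 1.1.1 (Theorem A): `u ≤_k w` iff conditions I and II hold. -/
theorem stmt0 (k : ℕ) (hk : 0 < k) (u w : Equiv.Perm ℕ+)
    (hu : finSupp u) (hw : finSupp w) :
    kBruhatLE k u w ↔ condIandII k u w := by
  exact ⟨fun h => (finSupp_and_condIandII_of_kBruhatLE hu h).2, kBruhatLE_of_condIandII (k := ⟨k, hk⟩) hu⟩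
end

section
/- Let ζ ∈ S_∞ and let k be a positive integer with #up_ζ ≤ k (the set up_ζ is finite since ζ fixes all but finitely many integers). Then there exists a permutation u ∈ S_∞ such that u ≤_k ζ∘u. -/
open Set in
/-- A permutation mapping a finite initial segment into itself also reflects it. -/
lemma lt_of_perm_apply_lt (σ : Equiv.Perm ℕ+) (m : ℕ+) (h : ∀ x < m, σ x < m) {x : ℕ+}
    (hx : σ x < m) : x < m := by
  have hs : SurjOn σ (Iio m) (Iio m) :=
    ((finite_Iio m).injOn_iff_bijOn_of_mapsTo (fun x hx => h x hx)).1 σ.injective.injOn |>.surjOn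
  obtain ⟨y, hy, hyx⟩ := hs (show σ x ∈ Iio m from hx)
  exact σ.injective hyx ▸ hy

/-- An injective self-map moving only finitely many points is bijective. -/
lemma bijective_of_injective_of_finite_moved {α : Type*} {f : α → α}
    (hf : Function.Injective f) (hfin : {x | f x ≠ x}.Finite) : Function.Bijective f := by
  refine ⟨hf, fun y => ?_⟩
  by_cases hy : f y = y
  · exact ⟨y, hy⟩
  · have hs := ((hfin.injOn_iff_bijOn_of_mapsTo
      (fun x hx h => hx (hf h))).1 hf.injOn).surjOn
    obtain ⟨x, -, hx⟩ := hs (show y ∈ {x | f x ≠ x} from hy)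
    exact ⟨x, hx⟩

lemma finSupp_inv {w : Equiv.Perm ℕ+} (hw : finSupp w) : finSupp w⁻¹ := by
  refine hw.subset fun i hi h => hi ?_
  rw [Equiv.Perm.inv_eq_iff_eq, h]

lemma finSupp_mul {v w : Equiv.Perm ℕ+} (hv : finSupp v) (hw : finSupp w) :
    finSupp (v * w) := by
  refine (hv.union hw).subset fun i hi => ?_
  by_contra h
  simp only [Set.mem_union, Set.mem_ofPred_eq, not_or, not_not] at h
  exact hi (by simp [h.1, h.2])

lemma finSupp_swap (a b : ℕ+) : finSupp (Equiv.swap a b) := by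
  refine (Set.toFinite {a, b}).subset fun i hi => ?_
  by_contra h
  simp only [Set.mem_insert_iff, Set.mem_singleton_iff, not_or] at h
  exact hi (Equiv.swap_apply_of_ne_of_ne h.1 h.2)

lemma finite_inversions_s5 {w : Equiv.Perm ℕ+} (hw : finSupp w) :
    {p : ℕ+ × ℕ+ | p.1 < p.2 ∧ w p.2 < w p.1}.Finite := by
  obtain ⟨N, hN⟩ := hw.bddAbove
  have hfix : ∀ i, N < i → w i = i := fun i hi => by
    by_contra h
    exact absurd (hN h) (not_le.2 hi)
  have hle : ∀ i, i ≤ N → w i ≤ N := fun i hi => by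
    by_contra! h
    have := w.injective (hfix _ h)
    order
  refine ((Set.finite_Iic N).prod (Set.finite_Iic N)).subset ?_
  rintro ⟨i, j⟩ ⟨hij, hw'⟩
  dsimp only at hij hw'
  have hj : j ≤ N := by
    by_contra! hj
    rw [hfix j hj] at hw'
    rcases le_or_gt i N with hi | hi
    · have := hle i hi
      order
    · rw [hfix i hi] at hw'
      order
  exact ⟨hij.le.trans hj, hj⟩

/-- Exchanging two values with no intermediate value at an intermediate position
raises the length by exactly one. -/
lemma len_mul_swap {v : Equiv.Perm ℕ+} (hv : finSupp v) {a b : ℕ+} (hab : a < b)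
    (hvab : v a < v b) (hbetween : ∀ c, a < c → c < b → ¬ (v a < v c ∧ v c < v b)) :
    len (v * Equiv.swap a b) = len v + 1 := by
  set σ := Equiv.swap a b with hσ
  have hσa : σ a = b := Equiv.swap_apply_left a b
  have hσb : σ b = a := Equiv.swap_apply_right a b
  have hσo : ∀ c, c ≠ a → c ≠ b → σ c = c := fun c => Equiv.swap_apply_of_ne_of_ne
  have hσσ : ∀ c, σ (σ c) = c := Equiv.swap_apply_self a b
  have hfin := finite_inversions_s5 (finSupp_mul hv (finSupp_swap a b))
  have hmem : (a, b) ∈ {p : ℕ+ × ℕ+ | p.1 < p.2 ∧ (v * σ) p.2 < (v * σ) p.1} := by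
    simpa [hσa, hσb] using ⟨hab, hvab⟩
  unfold len
  rw [← Set.ncard_sdiff_singleton_add_one hmem hfin]
  congr 1
  symm
  let f : ℕ+ × ℕ+ → ℕ+ × ℕ+ := fun p => if σ p.1 < σ p.2 then (σ p.1, σ p.2) else p
  have hff : ∀ p : ℕ+ × ℕ+, p.1 < p.2 → f (f p) = p := by
    rintro ⟨i, j⟩ h
    by_cases h' : σ i < σ j
    · simp only [f, h', if_true, hσσ, h]
    · simp only [f, h', if_false]
  have hcross : ∀ i j, i < j → ¬ σ i < σ j → (i = a ∧ j = b) ∨ (i = a ∧ a < j ∧ j < b) ∨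
      (j = b ∧ a < i ∧ i < b) := by
    intro i j hij hnot
    by_cases hia : i = a
    · subst hia
      rcases lt_trichotomy j b with hj | hj | hj
      · exact Or.inr (Or.inl ⟨rfl, hij, hj⟩)
      · exact Or.inl ⟨rfl, hj⟩
      · rw [hσa, hσo j hij.ne' hj.ne'] at hnot
        order
    · by_cases hib : i = b
      · subst hib
        rw [hσb, hσo j (hab.trans hij).ne' hij.ne'] at hnot
        order
      · rw [hσo i hia hib] at hnot
        by_cases hja : j = a
        · subst hja
          rw [hσa] at hnot
          order
        · by_cases hjb : j = b
          · subst hjb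
            rw [hσb] at hnot
            exact Or.inr (Or.inr ⟨rfl, lt_of_le_of_ne (not_lt.1 hnot) (Ne.symm hia), hij⟩)
          · rw [hσo j hja hjb] at hnot
            exact absurd hij hnot
  refine Set.BijOn.ncard_eq (f := f) (Set.InvOn.bijOn (f' := f)
    ⟨fun p hp => hff p hp.1, fun p hp => hff p hp.1.1⟩ ?_ ?_)
  · rintro ⟨i, j⟩ ⟨h1, h2⟩
    dsimp only at h1 h2
    by_cases h' : σ i < σ j
    · simp only [f, h', if_true]
      refine ⟨⟨h', by simpa [hσσ] using h2⟩, fun h => ?_⟩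
      simp only [Set.mem_singleton_iff, Prod.mk.injEq] at h
      have hi := hσσ i
      have hj := hσσ j
      rw [h.1, hσa] at hi
      rw [h.2, hσb] at hj
      order
    · simp only [f, h', if_false]
      simp only [Set.mem_sdiff, Set.mem_ofPred_eq, Equiv.Perm.mul_apply, Set.mem_singleton_iff,
        Prod.mk.injEq]
      rcases hcross i j h1 h' with ⟨rfl, rfl⟩ | ⟨rfl, hj1, hj2⟩ | ⟨rfl, hi1, hi2⟩
      · order
      · rw [hσa, hσo j hj1.ne' hj2.ne]
        exact ⟨⟨h1, h2.trans hvab⟩, fun h => hj2.ne h.2⟩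
      · rw [hσb, hσo i hi1.ne' hi2.ne]
        exact ⟨⟨h1, hvab.trans h2⟩, fun h => hi1.ne' h.1⟩
  · rintro ⟨i, j⟩ ⟨⟨h1, h2⟩, h3⟩
    simp only [Set.mem_singleton_iff, Prod.mk.injEq, Equiv.Perm.mul_apply] at h1 h2 h3
    by_cases h' : σ i < σ j
    · simp only [f, h', if_true]
      exact ⟨h', h2⟩
    · simp only [f, h', if_false]
      refine ⟨h1, ?_⟩
      dsimp only
      rcases hcross i j h1 h' with hij | ⟨rfl, hj1, hj2⟩ | ⟨rfl, hi1, hi2⟩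
      · exact absurd hij h3
      · rw [hσa, hσo j hj1.ne' hj2.ne] at h2
        by_contra! hle
        exact hbetween j hj1 hj2 ⟨lt_of_le_of_ne hle (v.injective.ne hj1.ne), h2⟩
      · rw [hσb, hσo i hi1.ne' hi2.ne] at h2
        by_contra! hle
        exact hbetween i hi1 hi2 ⟨h2, lt_of_le_of_ne hle (v.injective.ne hi2.ne)⟩

/-- The criterion characterising the `k`-Bruhat order: values weakly rise in positions at most
`k` and weakly fall in later positions, and no noninversion with both positions on the same side
of `k` becomes an inversion. -/
structure KBruhatCriterion (k : ℕ) (u w : Equiv.Perm ℕ+) : Prop where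
  le_left : ∀ a : ℕ+, (a : ℕ) ≤ k → u a ≤ w a
  le_right : ∀ b : ℕ+, k < (b : ℕ) → w b ≤ u b
  left_lt : ∀ a b : ℕ+, (a : ℕ) ≤ k → (b : ℕ) ≤ k → a < b → u a < u b → w a < w b
  right_lt : ∀ a b : ℕ+, k < (a : ℕ) → k < (b : ℕ) → a < b → u a < u b → w a < w b

namespace KBruhatCriterion

variable {k : ℕ} {u w : Equiv.Perm ℕ+}

lemma eq_of_left_eq (h : KBruhatCriterion k u w)
    (heq : ∀ a : ℕ+, (a : ℕ) ≤ k → u a = w a) : u = w := by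
  have hle : ∀ a, w a ≤ u a := fun a =>
    (le_or_gt (a : ℕ) k).elim (fun ha => (heq a ha).ge) (h.le_right a)
  have key : ∀ n : ℕ+, ∀ a, u a = n → w a = n := by
    intro n
    induction n using WellFoundedLT.induction with
    | ind n ih =>
      intro a ha
      by_contra hne
      have hlt : w a < n := lt_of_le_of_ne (ha ▸ hle a) hne
      have h2 : w (u⁻¹ (w a)) = w a := ih (w a) hlt _ (by simp)
      have h3 : u⁻¹ (w a) = a := w.injective h2
      rw [Equiv.Perm.inv_eq_iff_eq] at h3
      exact hne (h3.trans ha)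
  ext1 a
  exact (key _ a rfl).symm

/-- For a position `a ≤ k` with `u a < w a` and `u a` minimal, some position past `k`
has a `w`-value in `[u a, w a)` and a `u`-value at least `w a`. -/
lemma exists_right (h : KBruhatCriterion k u w) {a : ℕ+} (ha : u a < w a)
    (hmin : ∀ c : ℕ+, (c : ℕ) ≤ k → u c < u a → u c = w c) :
    ∃ b : ℕ+, k < (b : ℕ) ∧ u a ≤ w b ∧ w b < w a ∧ w a ≤ u b := by
  obtain ⟨b, hb1, hb2⟩ : ∃ b, w b < w a ∧ w a ≤ u b := by
    by_contra! hcon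
    have := lt_of_perm_apply_lt (u * w⁻¹) (w a) (x := w a)
      (fun x hx => by simpa using hcon (w⁻¹ x) (by simpa using hx)) (by simpa using ha)
    order
  refine ⟨b, ?_, ?_, hb1, hb2⟩
  · by_contra! hb
    have := h.le_left b hb
    order
  · by_contra! hlt
    have := lt_of_perm_apply_lt (w * u⁻¹) (u a) (x := u b) (fun x hx => ?_) (by simpa using hlt)
    · order
    · obtain ⟨c, rfl⟩ := u.surjective x
      suffices w c < u a by simpa using this
      rcases le_or_gt (c : ℕ) k with hc | hc
      · rwa [← hmin c hc hx]
      · exact (h.le_right c hc).trans_lt hx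

/-- Below a distinct `w` there is a cover still satisfying the criterion. -/
lemma exists_cover (h : KBruhatCriterion k u w) (hw : finSupp w) (hne : u ≠ w) :
    ∃ v, finSupp v ∧ KBruhatCriterion k u v ∧ kBruhatCover k v w := by
  obtain ⟨a, ⟨hak, hua⟩, hamin⟩ :
      ∃ a ∈ {a : ℕ+ | (a : ℕ) ≤ k ∧ u a < w a}, ∀ c ∈ {a : ℕ+ | (a : ℕ) ≤ k ∧ u a < w a},
        u a ≤ u c := by
    have hnon : {a : ℕ+ | (a : ℕ) ≤ k ∧ u a < w a}.Nonempty := by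
      by_contra hemp
      rw [Set.not_nonempty_iff_eq_empty, Set.eq_empty_iff_forall_notMem] at hemp
      exact hne (h.eq_of_left_eq fun a ha => le_antisymm (h.le_left a ha)
        (not_lt.1 fun hlt => hemp a ⟨ha, hlt⟩))
    exact ⟨Function.argminOn u _ hnon, Function.argminOn_mem u _ hnon,
      fun c hc => Function.argminOn_le u _ hc⟩
  have hmin : ∀ c : ℕ+, (c : ℕ) ≤ k → u c < u a → u c = w c := fun c hc hlt =>
    le_antisymm (h.le_left c hc) (not_lt.1 fun h' => absurd (hamin c ⟨hc, h'⟩) (not_le.2 hlt))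
  obtain ⟨b, ⟨hbk, hb1, hb2, hb3⟩, hbmax⟩ :
      ∃ b ∈ {b : ℕ+ | k < (b : ℕ) ∧ u a ≤ w b ∧ w b < w a ∧ w a ≤ u b},
        ∀ c ∈ {b : ℕ+ | k < (b : ℕ) ∧ u a ≤ w b ∧ w b < w a ∧ w a ≤ u b}, u c ≤ u b := by
    refine Set.exists_max_image _ u ?_ (h.exists_right hua hmin)
    exact ((Set.finite_Iio (w a)).preimage w.injective.injOn).subset fun c hc => hc.2.2.1
  have hab : a < b := by
    rw [← PNat.coe_lt_coe]
    omega
  have hva : (w * Equiv.swap a b) a = w b := by simp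
  have hvb : (w * Equiv.swap a b) b = w a := by simp
  have hvo : ∀ c, c ≠ a → c ≠ b → (w * Equiv.swap a b) c = w c := fun c h1 h2 => by
    simp [Equiv.swap_apply_of_ne_of_ne h1 h2]
  have hv : finSupp (w * Equiv.swap a b) := finSupp_mul hw (finSupp_swap a b)
  have hwv : w = w * Equiv.swap a b * Equiv.swap a b := by simp [mul_assoc]
  have hbetween : ∀ c, a < c → c < b → ¬ (w b < w c ∧ w c < w a) := by
    rintro c hac hcb ⟨h1, h2⟩
    rcases le_or_gt (c : ℕ) k with hc | hc
    · have h3 : u c < u a := by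
        by_contra! h3
        have := h.left_lt a c hak hc hac (lt_of_le_of_ne h3 (u.injective.ne hac.ne))
        order
      have := hmin c hc h3
      order
    · have h3 : u b < u c := by
        by_contra! h3
        have := h.right_lt c b hc hbk hcb (lt_of_le_of_ne h3 (u.injective.ne hcb.ne))
        order
      have := hbmax c ⟨hc, by order, h2, by order⟩
      order
  refine ⟨w * Equiv.swap a b, hv, ?_, a, b, hak, hbk, hwv, ?_⟩
  · have left_ne : ∀ c : ℕ+, (c : ℕ) ≤ k → c ≠ b := by rintro c hc rfl; omega
    have right_ne : ∀ c : ℕ+, k < (c : ℕ) → c ≠ a := by rintro c hc rfl; omega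
    refine ⟨fun c hc => ?_, fun c hc => ?_, fun c d hc hd hcd hu => ?_,
      fun c d hc hd hcd hu => ?_⟩
    · by_cases hca : c = a
      · rw [hca, hva]; exact hb1
      · rw [hvo c hca (left_ne c hc)]; exact h.le_left c hc
    · by_cases hcb : c = b
      · rw [hcb, hvb]; exact hb3
      · rw [hvo c (right_ne c hc) hcb]; exact h.le_right c hc
    · have hw' := h.left_lt c d hc hd hcd hu
      by_cases hca : c = a
      · subst hca
        rw [hva, hvo d hcd.ne' (left_ne d hd)]
        order
      · rw [hvo c hca (left_ne c hc)]
        by_cases hda : d = a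
        · subst hda
          rw [hva, ← hmin c hc hu]
          order
        · rwa [hvo d hda (left_ne d hd)]
    · have hw' := h.right_lt c d hc hd hcd hu
      by_cases hdb : d = b
      · subst hdb
        rw [hvb, hvo c (right_ne c hc) hcd.ne]
        order
      · rw [hvo d (right_ne d hd) hdb]
        by_cases hcb : c = b
        · subst hcb
          rw [hvb]
          by_contra! hle
          have hlt := lt_of_le_of_ne hle (w.injective.ne (right_ne d hd))
          have := hbmax d ⟨hd, by order, hlt, by order⟩
          order
        · rwa [hvo c (right_ne c hc) hcb]
  · conv_lhs => rw [hwv]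
    refine len_mul_swap hv hab (by rwa [hva, hvb]) fun c hac hcb => ?_
    rw [hva, hvb, hvo c hac.ne' hcb.ne]
    exact hbetween c hac hcb

theorem kBruhatLE (h : KBruhatCriterion k u w) (hw : finSupp w) : kBruhatLE k u w := by
  induction hn : len w generalizing w with
  | zero =>
    by_cases hne : u = w
    · exact hne ▸ Relation.ReflTransGen.refl
    · obtain ⟨v, -, -, a, b, -, -, -, hlen⟩ := h.exists_cover hw hne
      omega
  | succ n ih =>
    by_cases hne : u = w
    · exact hne ▸ Relation.ReflTransGen.refl
    · obtain ⟨v, hv, hc, hcov⟩ := h.exists_cover hw hne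
      have hlen : len w = len v + 1 := by
        obtain ⟨a, b, -, -, -, hlen⟩ := hcov
        exact hlen
      exact (ih hc hv (by omega)).tail hcov

end KBruhatCriterion

/-- The Grassmannian permutation with descent at `k = #W` and values `W` in the first
`k` positions. -/
lemma exists_grassmannian (W : Finset ℕ+) :
    ∃ w : Equiv.Perm ℕ+, finSupp w ∧ (∀ a : ℕ+, (a : ℕ) ≤ W.card ↔ w a ∈ W) ∧
      (∀ a b : ℕ+, (w a ∈ W ↔ w b ∈ W) → a < b → w a < w b) := by
  classical
  let c : ℕ+ → ℕ := fun x =>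
    if x ∈ W then (W.filter (· ≤ x)).card
    else W.card + ((Finset.Icc 1 x).filter (· ∉ W)).card
  have hin : ∀ x ∈ W, c x = (W.filter (· ≤ x)).card := fun x hx => if_pos hx
  have hout : ∀ x ∉ W, c x = W.card + ((Finset.Icc 1 x).filter (· ∉ W)).card :=
    fun x hx => if_neg hx
  have hout_lt : ∀ x ∉ W, W.card < c x := fun x hx => by
    rw [hout x hx]
    have : 0 < ((Finset.Icc 1 x).filter (· ∉ W)).card :=
      Finset.card_pos.2 ⟨x, by simp [hx]⟩
    omega
  have hin_le : ∀ x ∈ W, c x ≤ W.card := fun x hx => by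
    rw [hin x hx]
    exact Finset.card_filter_le _ _
  have hpos : ∀ x, 0 < c x := fun x => by
    by_cases hx : x ∈ W
    · rw [hin x hx]
      exact Finset.card_pos.2 ⟨x, by simp [hx]⟩
    · exact (Nat.zero_le _).trans_lt (hout_lt x hx)
  have hmono : ∀ x y, (x ∈ W ↔ y ∈ W) → x < y → c x < c y := fun x y hxy hlt => by
    by_cases hx : x ∈ W
    · have hy := hxy.1 hx
      rw [hin x hx, hin y hy]
      refine Finset.card_lt_card (Finset.ssubset_iff_of_subset ?_ |>.2 ⟨y, ?_, ?_⟩)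
      · intro z hz
        simp only [Finset.mem_filter] at hz ⊢
        exact ⟨hz.1, hz.2.trans hlt.le⟩
      · simp [hy]
      · simp [hlt]
    · have hy := fun h => hx (hxy.2 h)
      rw [hout x hx, hout y hy]
      refine Nat.add_lt_add_left (Finset.card_lt_card
        (Finset.ssubset_iff_of_subset ?_ |>.2 ⟨y, ?_, ?_⟩)) _
      · intro z hz
        simp only [Finset.mem_filter, Finset.mem_Icc] at hz ⊢
        exact ⟨⟨hz.1.1, hz.1.2.trans hlt.le⟩, hz.2⟩
      · simpa using hy
      · simp [hlt]
  have hinj : Function.Injective c := fun x y hxy => by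
    by_contra hne
    by_cases hW : x ∈ W ↔ y ∈ W
    · rcases lt_or_gt_of_ne hne with hlt | hlt
      · exact (hmono x y hW hlt).ne hxy
      · exact (hmono y x hW.symm hlt).ne' hxy
    · by_cases hx : x ∈ W <;> by_cases hy : y ∈ W
      · exact hW (by simp [hx, hy])
      · have := hin_le x hx; have := hout_lt y hy; omega
      · have := hin_le y hy; have := hout_lt x hx; omega
      · exact hW (by simp [hx, hy])
  let g : ℕ+ → ℕ+ := fun x => ⟨c x, hpos x⟩
  have hgc : ∀ x, (g x : ℕ) = c x := fun x => rfl
  have hginj : Function.Injective g := fun x y h => hinj (congrArg PNat.val h)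
  obtain ⟨N, hN⟩ := W.finite_toSet.bddAbove
  have hgfin : {x | g x ≠ x}.Finite := by
    refine (Set.finite_Iic N).subset fun x hx => ?_
    by_contra hxN
    simp only [Set.mem_Iic, not_le] at hxN
    have hxW : x ∉ W := fun h => absurd (hN h) (not_le.2 hxN)
    refine hx (PNat.eq ?_)
    have hsub : W ⊆ Finset.Icc 1 x := fun y hy =>
      Finset.mem_Icc.2 ⟨one_le, (hN hy).trans hxN.le⟩
    have hcard := Finset.card_sdiff_add_card_eq_card hsub
    rw [hgc, hout x hxW, Finset.filter_notMem_eq_sdiff]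
    rw [PNat.card_Icc] at hcard
    have : ((1 : ℕ+) : ℕ) = 1 := rfl
    omega
  let e : Equiv.Perm ℕ+ := Equiv.ofBijective g (bijective_of_injective_of_finite_moved hginj hgfin)
  have hec : ∀ a, c (e⁻¹ a) = a := fun a => congrArg PNat.val (e.apply_symm_apply a)
  refine ⟨e⁻¹, finSupp_inv hgfin, fun a => ⟨fun ha => ?_, fun ha => ?_⟩, fun a b hW hab => ?_⟩
  · by_contra hW
    have := hout_lt _ hW
    rw [hec] at this
    omega
  · have := hin_le _ ha
    rwa [hec] at this
  · by_contra! hle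
    have := hmono _ _ hW.symm (lt_of_le_of_ne hle ((e⁻¹).injective.ne hab.ne'))
    rw [hec, hec, PNat.coe_lt_coe] at this
    order

/-- Theorem 3.1.4(ii): if `#up_ζ ≤ k`, then some `u` satisfies `u ≤_k ζ∘u`. -/
theorem stmt5 (k : ℕ) (hk : 0 < k) (ζ : Equiv.Perm ℕ+) (hζ : finSupp ζ)
    (hcard : {α : ℕ+ | α < ζ α}.ncard ≤ k) :
    ∃ u : Equiv.Perm ℕ+, finSupp u ∧ kBruhatLE k u (ζ * u) := by
  classical
  have hup : {α : ℕ+ | α < ζ α}.Finite := hζ.subset fun α hα => (Set.mem_ofPred.1 hα).ne'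
  obtain ⟨T, hT, hTcard⟩ := hζ.infinite_compl.exists_subset_card_eq
    (k - {α : ℕ+ | α < ζ α}.ncard)
  have hTfix : ∀ x ∈ T, ζ x = x := fun x hx => not_not.1 (hT hx)
  have hdisj : Disjoint hup.toFinset T := by
    rw [Finset.disjoint_left]
    intro x hx hxT
    have h1 : x < ζ x := by simpa using hx
    exact h1.ne' (hTfix x hxT)
  let S : Finset ℕ+ := hup.toFinset ∪ T
  have hSk : (S.map ζ.toEmbedding).card = k := by
    rw [Finset.card_map, Finset.card_union_of_disjoint hdisj, hTcard,
      ← Set.ncard_eq_toFinset_card _ hup]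
    omega
  obtain ⟨w, hw, hwk, hwmono⟩ := exists_grassmannian (S.map ζ.toEmbedding)
  rw [hSk] at hwk
  have hmem : ∀ a : ℕ+, (a : ℕ) ≤ k ↔ (ζ⁻¹ * w) a ∈ S := fun a => by
    rw [hwk, Finset.mem_map_equiv]
    rfl
  have hζu : ∀ a, ζ ((ζ⁻¹ * w) a) = w a := fun a => by simp
  refine ⟨ζ⁻¹ * w, finSupp_mul (finSupp_inv hζ) hw, ?_⟩
  rw [mul_inv_cancel_left]
  refine KBruhatCriterion.kBruhatLE ⟨fun a ha => ?_, fun b hb => ?_, fun a b ha hb hab _ => ?_,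
    fun a b ha hb hab _ => ?_⟩ hw
  · rw [← hζu a]
    rcases Finset.mem_union.1 ((hmem a).1 ha) with h | h
    · exact le_of_lt (by simpa using h)
    · exact (hTfix _ h).ge
  · rw [← hζu b]
    by_contra! hlt
    exact absurd ((hmem b).2 (Finset.mem_union_left _ (by simpa using hlt))) (not_le.2 hb)
  · exact hwmono a b (by simp only [← hwk, ha, hb]) hab
  · exact hwmono a b (by simp only [← hwk, ha.not_ge, hb.not_ge]) hab
end
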